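/- Laplace asymptotics for the razor: let D : K → ℝ (K ⊂ ℝ^d compact) be smooth with a unique global minimum at an interior point Θ* where the Hessian J̃ = ∇²D(Θ*) is positive definite and D is bounded away from D(Θ*) outside any neighborhood of Θ*, and let w = √det J be a smooth positive weight. Then ∫_K w(Θ) e^{−N D(Θ)} dΘ = e^{−N D(Θ*)} (2π/N)^{d/2} (det J(Θ*))^{1/2} (det J̃)^{−1/2} (1 + O(1/N)) as N → ∞. Equivalently, −ln[∫_K w e^{−N D} dΘ / ∫_K w dΘ] = N D(Θ*) + (d/2) ln N − (1/2) ln(det J(Θ*)/det J̃) − ln((2π)^{d/2}/V) + O(1/N) with V = ∫_K w dΘ. -/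

import Mathlib

open MeasureTheory Real Filter Asymptotics Topology

lemma aux_exp1 {m u v : ℝ} (hu : m ≤ u) (hv : m ≤ v) :
    |rexp (-u) - rexp (-v)| ≤ |u - v| * rexp (-m) := by
  wlog h : u ≤ v generalizing u v
  · rw [abs_sub_comm, abs_sub_comm u v]; exact this hv hu (le_of_not_ge h)
  have h1 : rexp (-v) ≤ rexp (-u) := Real.exp_le_exp.2 (by linarith)
  have h2 : rexp (-u) ≤ rexp (-m) := Real.exp_le_exp.2 (by linarith)
  rw [abs_of_nonneg (by linarith), abs_of_nonpos (by linarith : u - v ≤ 0)]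
  have h3 : rexp (-v) = rexp (-u) * rexp (u - v) := by rw [← Real.exp_add]; ring_nf
  have h4 := Real.add_one_le_exp (u - v)
  have h5 := Real.exp_pos (-u)
  rw [h3]
  nlinarith [mul_le_mul_of_nonneg_left h4 h5.le, mul_le_mul_of_nonneg_left h2 (by linarith : 0 ≤ v - u)]

lemma aux_exp2 {m u v : ℝ} (hu : m ≤ u) (hv : m ≤ v) :
    |rexp (-u) - rexp (-v) + (u - v) * rexp (-v)| ≤ (u - v) ^ 2 * rexp (-m) := by
  have h2 : rexp (-u) ≤ rexp (-m) := Real.exp_le_exp.2 (by linarith)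
  have h2' : rexp (-v) ≤ rexp (-m) := Real.exp_le_exp.2 (by linarith)
  have h3 : rexp (-u) = rexp (-v) * rexp (v - u) := by rw [← Real.exp_add]; ring_nf
  have h5 := Real.exp_pos (-u)
  have h5' := Real.exp_pos (-v)
  have h4 := Real.add_one_le_exp (v - u)
  have h6 := Real.add_one_le_exp (u - v)
  have h0 : 0 ≤ rexp (-u) - rexp (-v) + (u - v) * rexp (-v) := by
    rw [h3]; nlinarith [mul_le_mul_of_nonneg_left h4 h5'.le]
  rw [abs_of_nonneg h0]
  have h7 : rexp (-v) = rexp (-u) * rexp (u - v) := by rw [← Real.exp_add]; ring_nf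
  have h8 : rexp (-u) - rexp (-v) ≤ (v - u) * rexp (-u) := by
    rw [h7]; nlinarith [mul_le_mul_of_nonneg_left h6 h5.le]
  have h9 : rexp (-v) - rexp (-u) ≤ (u - v) * rexp (-v) := by
    nlinarith [mul_le_mul_of_nonneg_left h4 h5'.le]
  have h10 : rexp (-u) - rexp (-v) + (u - v) * rexp (-v) ≤ (v - u) * (rexp (-u) - rexp (-v)) := by
    nlinarith
  have h11 := aux_exp1 hu hv
  calc _ ≤ (v - u) * (rexp (-u) - rexp (-v)) := h10
    _ ≤ |v - u| * |rexp (-u) - rexp (-v)| := by rw [← abs_mul]; exact le_abs_self _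
    _ ≤ |v - u| * (|u - v| * rexp (-m)) := by gcongr
    _ = _ := by rw [abs_sub_comm v u, ← mul_assoc, ← abs_mul, ← sq, abs_of_nonneg (sq_nonneg _)]

lemma aux_taylor {E : Type*} [NormedAddCommGroup E] [NormedSpace ℝ E] [FiniteDimensional ℝ E]
    (g : E → ℝ) (hg : ContDiff ℝ (⊤ : ℕ∞) g) (p : E) (n : ℕ) :
    ∃ M : ℝ, 0 ≤ M ∧ ∀ x : E, ‖x‖ ≤ 1 →
      |g (p + x) - ∑ k ∈ Finset.range (n + 1), (k.factorial : ℝ)⁻¹ * (iteratedFDeriv ℝ k g p (fun _ ↦ x))|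
        ≤ M * ‖x‖ ^ (n + 1) := by
  have hc : Continuous (iteratedFDeriv ℝ (n + 1) g) :=
    hg.continuous_iteratedFDeriv (by exact_mod_cast le_top)
  obtain ⟨M, hM⟩ := (isCompact_closedBall p 1).exists_bound_of_continuousOn hc.continuousOn
  have hM0 : 0 ≤ M := (norm_nonneg _).trans (hM p (by simp))
  refine ⟨(n.factorial : ℝ)⁻¹ * M, by positivity, fun x hx => ?_⟩
  have := map_add_eq_sum_add_integral_iteratedFDeriv (f := g) (x := p) (y := x) (n := n)
    (fun t _ => (hg.of_le (by exact_mod_cast le_top)).contDiffAt)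
  rw [this]
  simp only [smul_eq_mul, add_sub_cancel_left]
  rw [abs_mul, abs_of_nonneg (by positivity), mul_assoc]
  gcongr
  rw [← Real.norm_eq_abs]
  have := intervalIntegral.norm_integral_le_of_norm_le_const (a := 0) (b := 1) (C := M * ‖x‖ ^ (n + 1))
    (f := fun t : ℝ => (1 - t)^n * iteratedFDeriv ℝ (n + 1) g (p + t • x) (fun _ ↦ x)) ?_
  · simpa using this
  intro t ht
  rw [Set.uIoc_of_le zero_le_one] at ht
  have h1 : ‖(1 - t) ^ n‖ ≤ 1 := by
    rw [norm_pow]; apply pow_le_one₀ (norm_nonneg _)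
    rw [Real.norm_eq_abs, abs_le]; constructor <;> linarith [ht.1, ht.2]
  have h2 := hM (p + t • x) (by
    simp only [Metric.mem_closedBall, dist_self_add_left, norm_smul, Real.norm_eq_abs]
    rw [abs_of_pos ht.1]; nlinarith [ht.1, ht.2, norm_nonneg x])
  have h3 := (iteratedFDeriv ℝ (n + 1) g (p + t • x)).le_opNorm (fun _ ↦ x)
  simp only [Finset.prod_const, Finset.card_univ, Fintype.card_fin] at h3
  rw [norm_mul]
  calc _ ≤ 1 * (‖iteratedFDeriv ℝ (n + 1) g (p + t • x)‖ * ‖x‖ ^ (n+1)) := by gcongr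
    _ ≤ _ := by rw [one_mul]; gcongr

lemma aux_int {V : Type*} [NormedAddCommGroup V] [InnerProductSpace ℝ V] [FiniteDimensional ℝ V]
    [MeasurableSpace V] [BorelSpace V] {c : ℝ} (hc : 0 < c) (k : ℕ) :
    Integrable (fun y : V => ‖y‖ ^ (2 * k) * rexp (-(c * ‖y‖ ^ 2))) := by
  have h0 : Integrable (fun y : V => rexp (-(c/2) * ‖y‖^2)) := by
    apply Integrable.of_integral_ne_zero
    rw [GaussianFourier.integral_rexp_neg_mul_sq_norm (by positivity)]
    positivity
  refine (h0.const_mul (k.factorial * (2/c)^k)).mono' (by fun_prop) (ae_of_all _ fun y => ?_)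
  rw [Real.norm_of_nonneg (by positivity)]
  have h1 := Real.pow_div_factorial_le_exp (c/2 * ‖y‖^2) (by positivity) k
  rw [div_le_iff₀ (by positivity)] at h1
  have h2 : rexp (-(c * ‖y‖ ^ 2)) = rexp (-(c/2) * ‖y‖^2) * rexp (-(c/2) * ‖y‖^2) := by
    rw [← Real.exp_add]; ring_nf
  have h3 : rexp (c/2 * ‖y‖^2) * rexp (-(c/2) * ‖y‖^2) = 1 := by
    rw [← Real.exp_add]; simp
  have h4 : ‖y‖ ^ (2 * k) = (2/c)^k * (c/2 * ‖y‖^2)^k := by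
    rw [← mul_pow, pow_mul]; congr 1; field_simp
  rw [h4, h2]
  calc _ ≤ (2/c)^k * (rexp (c/2 * ‖y‖^2) * k.factorial) * (rexp (-(c/2) * ‖y‖^2) * rexp (-(c/2) * ‖y‖^2)) := by gcongr
    _ = k.factorial * (2/c)^k * (rexp (c/2 * ‖y‖^2) * rexp (-(c/2) * ‖y‖^2)) * rexp (-(c/2) * ‖y‖^2) := by ring
    _ = _ := by rw [h3, mul_one]

open scoped MatrixOrder in
lemma aux_matrix {d : ℕ} (Jt : Matrix (Fin d) (Fin d) ℝ) (h : Jt.PosDef) :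
    ∃ T : EuclideanSpace ℝ (Fin d) →ₗ[ℝ] EuclideanSpace ℝ (Fin d),
      LinearMap.det T ≠ 0 ∧ |LinearMap.det T| = √Jt.det ∧
      ∀ v, ∑ i, ∑ j, Jt i j * v i * v j = ‖T v‖ ^ 2 := by
  obtain ⟨y, hy, rfl⟩ := CStarAlgebra.isStrictlyPositive_iff_eq_star_mul_self.mp
        h.isStrictlyPositive
  have hd : LinearMap.det (Matrix.toEuclideanLin y) = y.det := by
    rw [Matrix.toEuclideanLin_eq_toLin_orthonormal, LinearMap.det_toLin]
  refine ⟨Matrix.toEuclideanLin y, ?_, ?_, ?_⟩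
  · rw [hd]; exact ((Matrix.isUnit_iff_isUnit_det _).1 hy).ne_zero
  · rw [hd, Matrix.det_mul, Matrix.star_eq_conjTranspose, Matrix.det_conjTranspose]
    simp [Real.sqrt_mul_self_eq_abs]
  · intro v
    rw [EuclideanSpace.norm_sq_eq]
    simp only [Real.norm_eq_abs, sq_abs]
    simp only [Matrix.toLpLin_apply, Matrix.mul_apply, Matrix.star_apply, star_trivial, Matrix.mulVec, dotProduct, sq, Finset.sum_mul, Finset.mul_sum]
    conv_lhs => enter [2, i]; rw [Finset.sum_comm]
    rw [Finset.sum_comm]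
    refine Finset.sum_congr rfl fun i _ => ?_
    refine Finset.sum_congr rfl fun j _ => Finset.sum_congr rfl fun k _ => ?_
    ring

lemma aux_gauss {d : ℕ} (T : EuclideanSpace ℝ (Fin d) →ₗ[ℝ] EuclideanSpace ℝ (Fin d))
    (hT : LinearMap.det T ≠ 0) :
    ∫ y, rexp (-(‖T y‖ ^ 2 / 2)) = (2 * π) ^ ((d : ℝ) / 2) / |LinearMap.det T| := by
  have h1 := Measure.map_linearMap_addHaar_eq_smul_addHaar (volume : Measure (EuclideanSpace ℝ (Fin d))) hT
  have hTc : Continuous T := T.continuous_of_finiteDimensional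
  have h2 := integral_map (μ := volume) (φ := T) hTc.aemeasurable (f := fun z => rexp (-(1/2) * ‖z‖ ^ 2)) (by fun_prop)
  rw [h1, integral_smul_measure, GaussianFourier.integral_rexp_neg_mul_sq_norm (by norm_num)] at h2
  have h3 : ∀ y, -(‖T y‖ ^ 2 / 2) = -(1/2) * ‖T y‖ ^ 2 := fun y => by ring
  simp_rw [h3]
  rw [← h2]
  simp [abs_inv, div_eq_mul_inv, mul_comm]

lemma aux_point {N t M c w0 q C R R' L S S' : ℝ} (hN : 0 ≤ N) (ht : 0 ≤ t) (ht1 : t ≤ 1)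
    (hM : 0 ≤ M) (hw0 : 0 ≤ w0) (hC : |C| ≤ M * t ^ 3) (hR : |R| ≤ M * t ^ 4) (hR' : |R'| ≤ M * t ^ 4)
    (hL : |L| ≤ M * t) (hS : |S| ≤ M * t ^ 2) (hS' : |S'| ≤ M * t ^ 2)
    (hq : c * t ^ 2 ≤ q) (ha : c * t ^ 2 ≤ q + C + R) (ha' : c * t ^ 2 ≤ q - C + R') :
    |(w0 + L + S) * rexp (-(N * (q + C + R))) + (w0 - L + S') * rexp (-(N * (q - C + R')))
        - 2 * w0 * rexp (-(N * q))| ≤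
      (8 * w0 * M ^ 2 + 2 * w0 * M + 4 * M ^ 2 + 2 * M) * (t ^ 2 + N * t ^ 4 + N ^ 2 * t ^ 6)
        * rexp (-(N * (c * t ^ 2))) := by
  set m := N * (c * t ^ 2)
  set e := rexp (-m)
  have he : 0 < e := Real.exp_pos _
  have hq' : m ≤ N * q := mul_le_mul_of_nonneg_left hq hN
  have hu : m ≤ N * (q + C + R) := mul_le_mul_of_nonneg_left ha hN
  have hu' : m ≤ N * (q - C + R') := mul_le_mul_of_nonneg_left ha' hN
  set u := N * (q + C + R) with hu_def
  set u' := N * (q - C + R') with hu'_def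
  have h43 : M * t ^ 4 ≤ M * t ^ 3 := by
    apply mul_le_mul_of_nonneg_left _ hM
    exact pow_le_pow_of_le_one ht ht1 (by norm_num)
  have d1 : |u - N * q| ≤ N * (2 * M * t ^ 3) := by
    rw [show u - N * q = N * (C + R) by rw [hu_def]; ring, abs_mul, abs_of_nonneg hN]
    gcongr; exact (abs_add_le _ _).trans (by linarith)
  have d2 : |u' - N * q| ≤ N * (2 * M * t ^ 3) := by
    rw [show u' - N * q = N * (-C + R') by rw [hu'_def]; ring, abs_mul, abs_of_nonneg hN]
    gcongr; exact (abs_add_le _ _).trans (by rw [abs_neg]; linarith)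
  have d3 : |u - u'| ≤ N * (4 * M * t ^ 3) := by
    rw [abs_le] at *; constructor <;> linarith
  have x1 := (aux_exp2 hu hq').trans (b := (u - N * q) ^ 2 * e) (c := (N * (2 * M * t ^ 3)) ^ 2 * e)
    (by rw [← sq_abs]; gcongr)
  have x2 := (aux_exp2 hu' hq').trans (b := (u' - N * q) ^ 2 * e) (c := (N * (2 * M * t ^ 3)) ^ 2 * e)
    (by rw [← sq_abs]; gcongr)
  have x3 := (aux_exp1 hu hu').trans (b := |u - u'| * e) (c := N * (4 * M * t ^ 3) * e) (by gcongr)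
  have x4 : |(u - N * q + (u' - N * q)) * rexp (-(N * q))| ≤ N * (2 * M * t ^ 4) * e := by
    rw [show u - N * q + (u' - N * q) = N * (R + R') by rw [hu'_def, hu_def]; ring, abs_mul, abs_mul,
      abs_of_nonneg hN, abs_of_pos (Real.exp_pos _)]
    have : |R + R'| ≤ 2 * M * t ^ 4 := (abs_add_le _ _).trans (by linarith)
    have : rexp (-(N * q)) ≤ e := Real.exp_le_exp.2 (by linarith)
    gcongr
  have x5 : |S * rexp (-u)| ≤ M * t ^ 2 * e := by
    rw [abs_mul, abs_of_pos (Real.exp_pos _)]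
    have : rexp (-u) ≤ e := Real.exp_le_exp.2 (by linarith)
    gcongr
  have x6 : |S' * rexp (-u')| ≤ M * t ^ 2 * e := by
    rw [abs_mul, abs_of_pos (Real.exp_pos _)]
    have : rexp (-u') ≤ e := Real.exp_le_exp.2 (by linarith)
    gcongr
  have x7 : |L * (rexp (-u) - rexp (-u'))| ≤ M * t * (N * (4 * M * t ^ 3) * e) := by
    rw [abs_mul]; gcongr
  have x8 : |w0 * ((rexp (-u) - rexp (-(N*q)) + (u - N*q) * rexp (-(N*q))) +
      (rexp (-u') - rexp (-(N*q)) + (u' - N*q) * rexp (-(N*q))) -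
      (u - N * q + (u' - N * q)) * rexp (-(N * q)))| ≤
      w0 * ((N * (2 * M * t ^ 3)) ^ 2 * e + (N * (2 * M * t ^ 3)) ^ 2 * e + N * (2 * M * t ^ 4) * e) := by
    rw [abs_mul, abs_of_nonneg hw0]
    gcongr
    rw [abs_le] at *; constructor <;> linarith
  have key : (w0 + L + S) * rexp (-u) + (w0 - L + S') * rexp (-u') - 2 * w0 * rexp (-(N * q)) =
     w0 * ((rexp (-u) - rexp (-(N*q)) + (u - N*q) * rexp (-(N*q))) +
      (rexp (-u') - rexp (-(N*q)) + (u' - N*q) * rexp (-(N*q))) -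
      (u - N * q + (u' - N * q)) * rexp (-(N * q))) + L * (rexp (-u) - rexp (-u')) +
      S * rexp (-u) + S' * rexp (-u') := by ring
  rw [key]
  have fin : w0 * ((N * (2 * M * t ^ 3)) ^ 2 * e + (N * (2 * M * t ^ 3)) ^ 2 * e + N * (2 * M * t ^ 4) * e)
     + M * t * (N * (4 * M * t ^ 3) * e) + M * t ^ 2 * e + M * t ^ 2 * e ≤ 
     (8 * w0 * M ^ 2 + 2 * w0 * M + 4 * M ^ 2 + 2 * M) * (t ^ 2 + N * t ^ 4 + N ^ 2 * t ^ 6) * e := by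
    rw [← sub_nonneg]
    have : 0 ≤ (8 * w0 * M ^ 2 * (t ^ 2 + N * t ^ 4) + 2 * w0 * M * (t ^ 2 + N ^ 2 * t ^ 6) +
      4 * M ^ 2 * (t ^ 2 + N ^ 2 * t ^ 6) + 2 * M * (N * t ^ 4 + N ^ 2 * t ^ 6)) * e := by positivity
    refine this.trans (le_of_eq ?_)
    ring
  refine le_trans ?_ fin
  refine (abs_add_le _ _).trans (add_le_add ?_ x6)
  refine (abs_add_le _ _).trans (add_le_add ?_ x5)
  exact (abs_add_le _ _).trans (add_le_add x8 x7)

lemma aux_main {E : Type*} [NormedAddCommGroup E] [InnerProductSpace ℝ E] [FiniteDimensional ℝ E]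
    [MeasurableSpace E] [BorelSpace E] (w f q : E → ℝ) (hw : Continuous w) (hf : Continuous f)
    (hqc : Continuous q) (hq2 : ∀ (s : ℝ) y, q (s • y) = s ^ 2 * q y)
    {c r A w0 : ℝ} (hc : 0 < c) (hr : 0 < r) (hA : 0 ≤ A) (hw0 : 0 ≤ w0) (hq : ∀ y, c * ‖y‖ ^ 2 ≤ q y)
    (hpt : ∀ (N : ℝ) x, 0 ≤ N → ‖x‖ < r → 
      |w x * rexp (-(N * f x)) + w (-x) * rexp (-(N * f (-x))) - 2 * w0 * rexp (-(N * q x))| ≤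
        A * (‖x‖ ^ 2 + N * ‖x‖ ^ 4 + N ^ 2 * ‖x‖ ^ 6) * rexp (-(N * (c * ‖x‖ ^ 2)))) :
    ∃ B, 0 ≤ B ∧ ∀ N : ℝ, 1 ≤ N → 
      |√N ^ (Module.finrank ℝ E) * (∫ x in Metric.ball (0 : E) r, w x * rexp (-(N * f x)))
        - w0 * ∫ y, rexp (- q y)| ≤ B / N := by
  set P : E → ℝ := fun y => (A * (‖y‖ ^ (2 * 1) * rexp (-(c * ‖y‖ ^ 2)) + ‖y‖ ^ (2 * 2) * rexp (-(c * ‖y‖ ^ 2)) + 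
    ‖y‖ ^ (2 * 3) * rexp (-(c * ‖y‖ ^ 2))) + 2 * w0 / r ^ 2 * (‖y‖ ^ (2 * 1) * rexp (-(c * ‖y‖ ^ 2)))) with hP
  have hPi : Integrable P :=
    ((((aux_int hc 1).add (aux_int hc 2)).add (aux_int hc 3)).const_mul A).add ((aux_int hc 1).const_mul _)
  have hP0 : ∀ y, 0 ≤ P y := fun y => by positivity
  refine ⟨(∫ y, P y) / 2, by have := integral_nonneg (μ := volume) (f := P) (fun y => hP0 y); positivity, fun N hN => ?_⟩
  have hN0 : 0 < N := by linarith
  have hs : 0 < √N := Real.sqrt_pos.2 hN0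
  have hsq : √N ^ 2 = N := Real.sq_sqrt hN0.le
  set F : E → ℝ := (Metric.ball (0 : E) r).indicator (fun x => w x * rexp (-(N * f x))) with hF
  have hFi : Integrable F := by
    rw [hF, integrable_indicator_iff measurableSet_ball]
    refine IntegrableOn.mono_set ?_ (Metric.ball_subset_closedBall)
    exact ContinuousOn.integrableOn_compact (isCompact_closedBall _ _) (by fun_prop)
  set s := (√N)⁻¹ with hs_def
  have hs0 : 0 < s := by positivity
  have hs2 : s ^ 2 = N⁻¹ := by rw [hs_def, inv_pow, hsq]
  have hG : Integrable (fun y => F (s • y)) := hFi.comp_smul hs0.ne'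
  have hG' : Integrable (fun y => F (s • (-y))) := hG.comp_neg
  have hQ : Integrable (fun y => rexp (- q y)) := by
    refine (aux_int (V := E) hc 0).mono' (by fun_prop) (ae_of_all _ fun y => ?_)
    rw [Real.norm_of_nonneg (Real.exp_pos _).le]
    simpa using hq y
  have e1 : √N ^ (Module.finrank ℝ E) * (∫ x in Metric.ball (0 : E) r, w x * rexp (-(N * f x))) =
      ∫ y, F (s • y) := by
    rw [Measure.integral_comp_smul, hF, integral_indicator measurableSet_ball, smul_eq_mul]
    congr 1
    rw [hs_def, inv_pow, inv_inv, abs_of_pos (by positivity)]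
  have e2 : ∫ y, F (s • (-y)) = ∫ y, F (s • y) := integral_neg_eq_self (fun y => F (s • y)) _
  have e3 : ∫ y, (F (s • y) + F (s • (-y)) - 2 * w0 * rexp (- q y)) = 
      2 * ((∫ y, F (s • y)) - w0 * ∫ y, rexp (- q y)) := by
    have hGG : Integrable (fun y => F (s • y) + F (s • (-y))) := hG.add hG'
    rw [integral_sub hGG (hQ.const_mul _), integral_add hG hG', integral_const_mul, e2]; ring
  have e4 : |∫ y, (F (s • y) + F (s • (-y)) - 2 * w0 * rexp (- q y))| ≤ ∫ y, N⁻¹ * P y := by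
    rw [← Real.norm_eq_abs]
    refine norm_integral_le_of_norm_le (hPi.const_mul _) (ae_of_all _ fun y => ?_)
    rw [Real.norm_eq_abs]
    have hns : ‖s • y‖ = s * ‖y‖ := by rw [norm_smul, Real.norm_of_nonneg hs0.le]
    have hQN : N * q (s • y) = q y := by rw [hq2, hs2]; field_simp
    have hn2 : ‖s • y‖ ^ 2 = N⁻¹ * ‖y‖ ^ 2 := by rw [hns, mul_pow, hs2]
    by_cases hy : ‖s • y‖ < r
    · have h1 : s • y ∈ Metric.ball (0 : E) r := by simpa using hy
      have h2 : s • (-y) ∈ Metric.ball (0 : E) r := by simpa using hy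
      rw [hF, Set.indicator_of_mem h1, Set.indicator_of_mem h2]
      have := hpt N (s • y) hN0.le hy
      rw [hQN, ← smul_neg] at this
      refine this.trans ?_
      rw [show N * (c * ‖s • y‖ ^ 2) = c * ‖y‖ ^ 2 by rw [hn2]; field_simp]
      rw [show ‖s • y‖ ^ 4 = (‖s • y‖ ^ 2) ^ 2 by ring, show ‖s • y‖ ^ 6 = (‖s • y‖ ^ 2) ^ 3 by ring, hn2]
      rw [hP]
      have : 0 ≤ N⁻¹ * (2 * w0 / r ^ 2 * (‖y‖ ^ (2 * 1) * rexp (-(c * ‖y‖ ^ 2)))) := by positivity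
      beta_reduce
      rw [mul_add N⁻¹]
      refine le_trans (le_of_eq ?_) (le_add_of_nonneg_right this)
      field_simp
      ring
    · have h1 : s • y ∉ Metric.ball (0 : E) r := by simpa using hy
      have h2 : s • (-y) ∉ Metric.ball (0 : E) r := by simpa using hy
      rw [hF, Set.indicator_of_notMem h1, Set.indicator_of_notMem h2]
      push Not at hy
      have h3 : 1 ≤ N⁻¹ * ‖y‖ ^ 2 / r ^ 2 := by
        rw [← hn2, one_le_div (by positivity)]; gcongr
      have h4 : rexp (- q y) ≤ rexp (-(c * ‖y‖ ^ 2)) := Real.exp_le_exp.2 (by linarith [hq y])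
      rw [add_zero, zero_sub, abs_neg, abs_of_nonneg (by positivity)]
      calc 2 * w0 * rexp (- q y) ≤ 2 * w0 * rexp (-(c * ‖y‖ ^ 2)) * 1 := by rw [mul_one]; gcongr
        _ ≤ 2 * w0 * rexp (-(c * ‖y‖ ^ 2)) * (N⁻¹ * ‖y‖ ^ 2 / r ^ 2) := by gcongr
        _ = N⁻¹ * (2 * w0 / r ^ 2 * (‖y‖ ^ (2 * 1) * rexp (-(c * ‖y‖ ^ 2)))) := by ring
        _ ≤ _ := by
          rw [hP]; gcongr; apply le_add_of_nonneg_left; positivity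
  rw [e3, integral_const_mul, abs_mul, abs_of_pos (by norm_num : (0:ℝ) < 2)] at e4
  rw [e1]
  calc _ ≤ (N⁻¹ * ∫ y, P y) / 2 := by linarith
    _ = _ := by ring

lemma aux_local {d : ℕ}
    (D w : EuclideanSpace ℝ (Fin d) → ℝ) (hD : ContDiff ℝ (⊤ : ℕ∞) D) (hw : ContDiff ℝ (⊤ : ℕ∞) w)
    (p : EuclideanSpace ℝ (Fin d)) (hw0 : 0 ≤ w p) (hcrit : fderiv ℝ D p = 0)
    (T : EuclideanSpace ℝ (Fin d) →ₗ[ℝ] EuclideanSpace ℝ (Fin d)) (hT : LinearMap.det T ≠ 0)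
    (hHess : ∀ v, iteratedFDeriv ℝ 2 D p ![v, v] = ‖T v‖ ^ 2) (r0 : ℝ) (hr0 : 0 < r0) :
    ∃ r B, 0 < r ∧ r ≤ r0 ∧ 0 ≤ B ∧ ∀ N : ℝ, 1 ≤ N →
      |√N ^ d * (∫ x in Metric.ball 0 r, w (p + x) * rexp (-(N * (D (p + x) - D p))))
        - w p * ((2 * π) ^ ((d : ℝ) / 2) / |LinearMap.det T|)| ≤ B / N := by
  have hTc : Continuous T := T.continuous_of_finiteDimensional
  have hker : LinearMap.ker T = ⊥ := by
    by_contra h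
    exact hT (LinearMap.det_eq_zero_iff_ker_ne_bot.2 h)
  obtain ⟨κ, hκ0, hκ⟩ := T.exists_antilipschitzWith hker
  have hκ0' : (0 : ℝ) < κ := hκ0
  have hκ' : ∀ y, ‖y‖ ≤ κ * ‖T y‖ := fun y => by
    have := hκ.le_mul_dist y 0
    simpa using this
  set c : ℝ := 1 / (4 * κ ^ 2) with hc_def
  have hc : 0 < c := by positivity
  have hq : ∀ y, 2 * c * ‖y‖ ^ 2 ≤ ‖T y‖ ^ 2 / 2 := fun y => by
    have : ‖y‖ ^ 2 ≤ (κ * ‖T y‖) ^ 2 := by gcongr; exact hκ' y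
    calc 2 * c * ‖y‖ ^ 2 ≤ 2 * c * (κ * ‖T y‖) ^ 2 := by gcongr
      _ = _ := by rw [hc_def]; field_simp; norm_num
  obtain ⟨M1, hM1, hD4⟩ := aux_taylor D hD p 3
  obtain ⟨M2, hM2, hw2⟩ := aux_taylor w hw p 1
  set C : EuclideanSpace ℝ (Fin d) → ℝ := fun x => (6 : ℝ)⁻¹ * iteratedFDeriv ℝ 3 D p (fun _ ↦ x) with hC
  set L := fderiv ℝ w p with hL
  set M := M1 + M2 + ‖iteratedFDeriv ℝ 3 D p‖ + ‖L‖ with hM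
  have hM0 : 0 ≤ M := by positivity
  have hCodd : ∀ x, C (-x) = - C x := fun x => by
    have := (iteratedFDeriv ℝ 3 D p).map_smul_univ (fun _ => (-1 : ℝ)) (fun _ => x)
    simp only [neg_smul, one_smul, Finset.prod_const, Finset.card_univ, Fintype.card_fin] at this
    simp only [hC, this]; norm_num
  have hCb : ∀ x, |C x| ≤ M * ‖x‖ ^ 3 := fun x => by
    have h3 := (iteratedFDeriv ℝ 3 D p).le_opNorm (fun _ ↦ x)
    simp only [Finset.prod_const, Finset.card_univ, Fintype.card_fin] at h3
    rw [hC, abs_mul, abs_of_pos (by norm_num)]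
    rw [Real.norm_eq_abs] at h3
    have : ‖iteratedFDeriv ℝ 3 D p‖ ≤ M := by rw [hM]; linarith [norm_nonneg L]
    have h4 : ‖iteratedFDeriv ℝ 3 D p‖ * ‖x‖ ^ 3 ≤ M * ‖x‖ ^ 3 := by gcongr
    have h5 := abs_nonneg (iteratedFDeriv ℝ 3 D p (fun _ ↦ x))
    linarith
  have hLb : ∀ x, |L x| ≤ M * ‖x‖ := fun x => by
    have h3 := L.le_opNorm x
    have : ‖L‖ ≤ M := by rw [hM]; linarith [norm_nonneg (iteratedFDeriv ℝ 3 D p)]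
    exact h3.trans (by gcongr)
  have hDb : ∀ x, ‖x‖ ≤ 1 → |D (p + x) - D p - (‖T x‖ ^ 2 / 2 + C x)| ≤ M * ‖x‖ ^ 4 := fun x hx => by
    have h := hD4 x hx
    have hv : (fun _ : Fin 2 => x) = ![x, x] := by ext i; fin_cases i <;> rfl
    have h1 : M1 ≤ M := by rw [hM]; linarith [norm_nonneg (iteratedFDeriv ℝ 3 D p), norm_nonneg L]
    have h2 : M1 * ‖x‖ ^ 4 ≤ M * ‖x‖ ^ 4 := by gcongr
    simp only [Finset.sum_range_succ, Finset.sum_range_zero, iteratedFDeriv_zero_apply,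
      iteratedFDeriv_one_apply, hcrit, hv, hHess] at h
    refine le_trans (le_of_eq ?_) (h.trans h2)
    simp [hC, Nat.factorial]
    ring_nf
  have hwb : ∀ x, ‖x‖ ≤ 1 → |w (p + x) - w p - L x| ≤ M * ‖x‖ ^ 2 := fun x hx => by
    have h := hw2 x hx
    have h1 : M2 ≤ M := by rw [hM]; linarith [norm_nonneg (iteratedFDeriv ℝ 3 D p), norm_nonneg L]
    have h2 : M2 * ‖x‖ ^ 2 ≤ M * ‖x‖ ^ 2 := by gcongr
    simp only [Finset.sum_range_succ, Finset.sum_range_zero, iteratedFDeriv_zero_apply,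
      iteratedFDeriv_one_apply] at h
    refine le_trans (le_of_eq ?_) (h.trans h2)
    simp [hL]
    ring_nf
  set r := min r0 (min 1 (c / (2 * M + 1))) with hr
  have hrpos : 0 < r := by positivity
  have hr1 : r ≤ 1 := (min_le_right _ _).trans (min_le_left _ _)
  have hr2 : 2 * M * r ≤ c := by
    have : r ≤ c / (2 * M + 1) := (min_le_right _ _).trans (min_le_right _ _)
    rw [le_div_iff₀ (by positivity)] at this
    nlinarith
  obtain ⟨B, hB, hmain⟩ := aux_main (fun x => w (p + x)) (fun x => D (p + x) - D p)
    (fun y => ‖T y‖ ^ 2 / 2) (by have := hw.continuous; fun_prop) (by have := hD.continuous; fun_prop)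
    (by fun_prop) (fun s y => by simp [norm_smul, mul_pow]; ring) (c := c) (r := r)
    (A := 8 * w p * M ^ 2 + 2 * w p * M + 4 * M ^ 2 + 2 * M) (w0 := w p) hc hrpos (by positivity) hw0
    (fun y => le_trans (by gcongr; linarith) (hq y)) (fun N x hN hx => by
      have hx1 : ‖x‖ ≤ 1 := by linarith
      have hx1' : ‖-x‖ ≤ 1 := by rwa [norm_neg]
      have a1 := hDb x hx1
      have a2 := hDb (-x) hx1'
      have b1 := hwb x hx1
      have b2 := hwb (-x) hx1'
      rw [hCodd, map_neg, norm_neg, norm_neg] at a2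
      rw [map_neg, norm_neg] at b2
      have hCx := hCb x
      have h3 : 2 * M * ‖x‖ ^ 3 ≤ c * ‖x‖ ^ 2 := by
        have : 2 * M * ‖x‖ ≤ c := le_trans (by gcongr) hr2
        calc _ = 2 * M * ‖x‖ * ‖x‖ ^ 2 := by ring
          _ ≤ _ := by gcongr
      have h43 : M * ‖x‖ ^ 4 ≤ M * ‖x‖ ^ 3 := by
        apply mul_le_mul_of_nonneg_left _ hM0
        exact pow_le_pow_of_le_one (norm_nonneg _) hx1 (by norm_num)
      have hqx := hq x
      have hc0 : 0 ≤ c * ‖x‖ ^ 2 := by positivity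
      have := aux_point (N := N) (t := ‖x‖) (M := M) (c := c) (w0 := w p) (q := ‖T x‖ ^ 2 / 2) (C := C x)
        (R := D (p + x) - D p - (‖T x‖ ^ 2 / 2 + C x)) (R' := D (p + -x) - D p - (‖T x‖ ^ 2 / 2 + - C x))
        (L := L x) (S := w (p + x) - w p - L x) (S' := w (p + -x) - w p - - L x)
        hN (norm_nonneg _) hx1 hM0 hw0 hCx a1 a2 (hLb x) b1 b2
        (by linarith) (by rw [abs_le] at *; linarith [hCx.1, hCx.2, a1.1, a1.2])
        (by rw [abs_le] at *; linarith [hCx.1, hCx.2, a2.1, a2.2])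
      convert this using 5 <;> ring_nf)
  refine ⟨r, B, hrpos, min_le_left _ _, hB, fun N hN => ?_⟩
  have := hmain N hN
  rw [aux_gauss T hT, finrank_euclideanSpace_fin] at this
  exact this

/-- Laplace asymptotics for the razor: with a unique interior nondegenerate
minimum `Θ*` of `D` and weight `w = √det J`,
`∫_K w e^{−N D} = e^{−N D(Θ*)} (2π/N)^{d/2} √(det J(Θ*)) / √(det J̃) (1 + O(1/N))`. -/
theorem stmt17 {d : ℕ} (K : Set (EuclideanSpace ℝ (Fin d))) (hK : IsCompact K)
    (hKm : MeasurableSet K)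
    (D : EuclideanSpace ℝ (Fin d) → ℝ) (hD : ContDiff ℝ (⊤ : ℕ∞) D)
    (θstar : EuclideanSpace ℝ (Fin d)) (hθK : θstar ∈ interior K)
    (hmin : ∀ θ ∈ K, θ ≠ θstar → D θstar < D θ)
    (hsep : ∀ U ∈ 𝓝 θstar, ∃ b > (0 : ℝ), ∀ θ ∈ K \ U, D θstar + b ≤ D θ)
    (J : EuclideanSpace ℝ (Fin d) → Matrix (Fin d) (Fin d) ℝ)
    (hJsmooth : ∀ i j, ContDiff ℝ (⊤ : ℕ∞) fun θ => J θ i j)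
    (hJpos : ∀ θ, (J θ).PosDef)
    (Jt : Matrix (Fin d) (Fin d) ℝ) (hJtpos : Jt.PosDef)
    (hHess : ∀ v : EuclideanSpace ℝ (Fin d),
      iteratedFDeriv ℝ 2 D θstar ![v, v] = ∑ i, ∑ j, Jt i j * v i * v j) :
    (fun N : ℕ =>
        (∫ θ in K, Real.sqrt (J θ).det * Real.exp (-(N : ℝ) * D θ)) /
          (Real.exp (-(N : ℝ) * D θstar) * (2 * Real.pi / N) ^ ((d : ℝ) / 2) *
            Real.sqrt (J θstar).det / Real.sqrt Jt.det) - 1)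
      =O[atTop] fun N : ℕ => 1 / (N : ℝ) := by
  set w : EuclideanSpace ℝ (Fin d) → ℝ := fun θ => √(J θ).det with hw_def
  have hwpos : ∀ θ, 0 < w θ := fun θ => Real.sqrt_pos.2 (hJpos θ).det_pos
  have hw : ContDiff ℝ (⊤ : ℕ∞) w := by
    refine ContDiff.sqrt ?_ (fun θ => (hJpos θ).det_pos.ne')
    simp_rw [Matrix.det_apply]
    refine ContDiff.sum fun σ _ => ContDiff.const_smul _ ?_
    exact contDiff_prod fun i _ => hJsmooth _ _
  obtain ⟨T, hT, hTd, hTq⟩ := aux_matrix Jt hJtpos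
  have hcrit : fderiv ℝ D θstar = 0 := by
    apply IsLocalMin.fderiv_eq_zero
    filter_upwards [mem_interior_iff_mem_nhds.1 hθK] with θ hθ
    by_cases h : θ = θstar
    · rw [h]
    · exact (hmin θ hθ h).le
  obtain ⟨r0, hr0, hrK⟩ := Metric.mem_nhds_iff.1 (mem_interior_iff_mem_nhds.1 hθK)
  obtain ⟨r, B, hr, hrr, hB, hloc⟩ := aux_local D w hD hw θstar (hwpos _).le hcrit T hT
    (fun v => by rw [hHess, hTq]) r0 hr0
  obtain ⟨b, hb, hbK⟩ := hsep _ (Metric.ball_mem_nhds θstar hr)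
  have hballK : Metric.ball θstar r ⊆ K := (Metric.ball_subset_ball hrr).trans hrK
  obtain ⟨W, hW⟩ := hK.exists_bound_of_continuousOn hw.continuous.continuousOn
  have hW0 : 0 ≤ W := (norm_nonneg _).trans (hW θstar (interior_subset hθK))
  set Z := (2 * π) ^ ((d : ℝ) / 2) / √Jt.det with hZ
  have hdetJ : 0 < √Jt.det := Real.sqrt_pos.2 hJtpos.det_pos
  have hZpos : 0 < Z := by positivity
  set vK := volume.real K
  have hw0 := hwpos θstar
  have hDc := hD.continuous
  have hwc := hw.continuous
  set Q : ℝ := W * vK * ((d + 1).factorial / b ^ (d + 1)) with hQ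
  have hQ0 : 0 ≤ Q := by positivity
  refine IsBigO.of_bound ((Q + B) / (w θstar * Z)) ?_
  filter_upwards [eventually_ge_atTop 1] with n hn
  have hN : (1 : ℝ) ≤ n := by exact_mod_cast hn
  set N : ℝ := (n : ℝ)
  have hN0 : 0 < N := by linarith
  have hs : 0 < √N := Real.sqrt_pos.2 hN0
  set g := fun θ => w θ * rexp (-(N * (D θ - D θstar))) with hg
  have hgc : Continuous g := by fun_prop
  have i1 : ∫ θ in K, w θ * rexp (-N * D θ) = rexp (-N * D θstar) * ∫ θ in K, g θ := by
    rw [← integral_const_mul]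
    congr 1; ext θ
    rw [hg]; simp only
    rw [mul_left_comm, ← Real.exp_add]; ring_nf
  have i2 : ∫ θ in K, g θ = (∫ θ in K \ Metric.ball θstar r, g θ) + ∫ θ in Metric.ball θstar r, g θ := by
    have hgi : IntegrableOn g K := hgc.continuousOn.integrableOn_compact hK
    have := setIntegral_sdiff (measurableSet_ball (x := θstar) (ε := r)) hgi hballK
    rw [this]; ring
  have i3 : ∫ θ in Metric.ball θstar r, g θ = 
      ∫ x in Metric.ball 0 r, w (θstar + x) * rexp (-(N * (D (θstar + x) - D θstar))) := by
    rw [← integral_indicator measurableSet_ball, ← integral_indicator measurableSet_ball,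
      ← integral_add_left_eq_self _ θstar]
    congr 1; ext x
    simp only [Set.indicator, Metric.mem_ball, dist_self_add_left, dist_zero_right, hg]
  have i4 : |∫ θ in K \ Metric.ball θstar r, g θ| ≤ W * vK * rexp (-(N * b)) := by
    have hlt : volume (K \ Metric.ball θstar r) < ⊤ :=
      (measure_mono Set.sdiff_subset).trans_lt hK.measure_lt_top
    have := norm_setIntegral_le_of_norm_le_const (f := g) (C := W * rexp (-(N * b))) hlt
      (fun θ hθ => by
        rw [hg, norm_mul, Real.norm_of_nonneg (Real.exp_pos _).le]
        have h1 := hW θ hθ.1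
        have h2 := hbK θ hθ
        have h3 : b ≤ D θ - D θstar := by linarith
        gcongr)
    have h5 : volume.real (K \ Metric.ball θstar r) ≤ vK :=
      measureReal_mono Set.sdiff_subset hK.measure_lt_top.ne
    rw [← Real.norm_eq_abs]
    calc _ ≤ _ := this
      _ ≤ W * rexp (-(N * b)) * vK := by gcongr
      _ = _ := by ring
  have i5 : √N ^ d * (W * vK * rexp (-(N * b))) ≤ Q / N := by
    have h1 : √N ^ d ≤ N ^ d := by
      gcongr; exact Real.sqrt_le_iff.2 ⟨hN0.le, by nlinarith⟩
    have h2 := Real.pow_div_factorial_le_exp (N * b) (by positivity) (d + 1)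
    have h3 : N ^ d * rexp (-(N * b)) ≤ ((d + 1).factorial / b ^ (d + 1)) / N := by
      rw [Real.exp_neg, ← div_eq_mul_inv, div_le_iff₀ (Real.exp_pos _)]
      calc N ^ d = ((d + 1).factorial / b ^ (d + 1)) / N * ((N * b) ^ (d + 1) / (d + 1).factorial) := by
            field_simp
            ring
        _ ≤ _ := by gcongr
    calc _ ≤ N ^ d * (W * vK * rexp (-(N * b))) := by gcongr
      _ = W * vK * (N ^ d * rexp (-(N * b))) := by ring
      _ ≤ W * vK * (((d + 1).factorial / b ^ (d + 1)) / N) := by gcongr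
      _ = _ := by rw [hQ]; ring
  have i6 : (2 * π / N) ^ ((d : ℝ) / 2) = (2 * π) ^ ((d : ℝ) / 2) / √N ^ d := by
    rw [Real.div_rpow (by positivity) hN0.le]
    congr 1
    rw [Real.sqrt_eq_rpow, ← Real.rpow_natCast, ← Real.rpow_mul hN0.le]; ring_nf
  have i7 := hloc N hN
  rw [hTd, ← i3] at i7
  have hDen : rexp (-N * D θstar) * (2 * π / N) ^ ((d : ℝ) / 2) * w θstar / √Jt.det =
      rexp (-N * D θstar) * (w θstar * Z / √N ^ d) := by
    rw [i6, hZ]; ring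
  change ‖(∫ θ in K, w θ * rexp (-N * D θ)) / (rexp (-N * D θstar) * (2 * π / N) ^ ((d : ℝ) / 2) * w θstar / √Jt.det) - 1‖ ≤ _
  have i8 : (∫ θ in K, w θ * rexp (-N * D θ)) / (rexp (-N * D θstar) * (2 * π / N) ^ ((d : ℝ) / 2) * w θstar / √Jt.det) - 1
      = (√N ^ d * (∫ θ in K \ Metric.ball θstar r, g θ) + 
        (√N ^ d * (∫ θ in Metric.ball θstar r, g θ) - w θstar * Z)) / (w θstar * Z) := by
    rw [hDen, i1, mul_div_mul_left _ _ (Real.exp_pos _).ne', i2]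
    field_simp
    ring
  rw [i8, norm_div, Real.norm_of_nonneg (by positivity : 0 ≤ w θstar * Z), Real.norm_of_nonneg (by positivity : 0 ≤ 1 / N)]
  rw [div_mul_eq_mul_div]
  gcongr
  calc _ ≤ √N ^ d * |∫ θ in K \ Metric.ball θstar r, g θ| + B / N := by
        refine (norm_add_le _ _).trans (add_le_add (le_of_eq ?_) i7)
        rw [norm_mul, Real.norm_of_nonneg (by positivity), Real.norm_eq_abs]
    _ ≤ √N ^ d * (W * vK * rexp (-(N * b))) + B / N := by gcongr
    _ ≤ Q / N + B / N := by gcongr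
    _ = _ := by ring
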